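/- Let F : ℝ × ℝ → ℝ be a Borel measurable, locally bounded function satisfying equation (B) with weight ω, and let q ≥ 0 with W^{(q)} as in the context. Then for all x ≥ y one has F(x,y) − W^{(q)}(x−y) = ∫_y^x F(x,z) (ω(z) − q) W^{(q)}(z−y) dz. -/

import Mathlib

open MeasureTheory Set

noncomputable section

/-- A real-valued function is locally bounded if it is bounded on every compact set. -/
def LocBdd {α : Type*} [TopologicalSpace α] (f : α → ℝ) : Prop :=
  ∀ K : Set α, IsCompact K → ∃ C : ℝ, ∀ x ∈ K, |f x| ≤ C

/-- A locally bounded measurable function on `ℝ` is interval integrable. -/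
lemma LocBdd.intervalIntegrable {h : ℝ → ℝ} (hb : LocBdd h) (hm : Measurable h) (a b : ℝ) :
    IntervalIntegrable h volume a b := by
  obtain ⟨C, hC⟩ := hb (uIcc a b) isCompact_uIcc
  rw [intervalIntegrable_iff]
  exact Measure.integrableOn_of_bounded (M := C) (by simp [uIoc]) hm.aestronglyMeasurable
    ((ae_restrict_iff' measurableSet_uIoc).2 (.of_forall fun t ht ↦ hC t (uIoc_subset_uIcc ht)))

lemma LocBdd.mul {α : Type*} [TopologicalSpace α] {f g : α → ℝ} (hf : LocBdd f) (hg : LocBdd g) :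
    LocBdd fun t ↦ f t * g t := by
  intro K hK
  obtain ⟨C, hC⟩ := hf K hK
  obtain ⟨D, hD⟩ := hg K hK
  refine ⟨C * D, fun t ht ↦ ?_⟩
  rw [abs_mul]
  exact mul_le_mul (hC t ht) (hD t ht) (abs_nonneg _) ((abs_nonneg _).trans (hC t ht))

lemma LocBdd.comp_continuous {α β : Type*} [TopologicalSpace α] [TopologicalSpace β] {f : β → ℝ}
    (hf : LocBdd f) {φ : α → β} (hφ : Continuous φ) : LocBdd fun t ↦ f (φ t) := by
  intro K hK
  obtain ⟨C, hC⟩ := hf (φ '' K) (hK.image hφ)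
  exact ⟨C, fun t ht ↦ hC _ (mem_image_of_mem _ ht)⟩

/-- Fubini's theorem on a rectangle for a locally bounded measurable function. -/
lemma LocBdd.intervalIntegral_swap {h : ℝ × ℝ → ℝ} (hb : LocBdd h) (hm : Measurable h)
    {a b c d : ℝ} (hab : a ≤ b) (hcd : c ≤ d) :
    ∫ s in a..b, ∫ t in c..d, h (s, t) = ∫ t in c..d, ∫ s in a..b, h (s, t) := by
  simp only [intervalIntegral.integral_of_le hab, intervalIntegral.integral_of_le hcd]
  obtain ⟨C, hC⟩ := hb (Icc a b ×ˢ Icc c d) (isCompact_Icc.prod isCompact_Icc)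
  refine integral_integral_swap (f := fun s t ↦ h (s, t)) ?_
  rw [Measure.prod_restrict]
  refine Measure.integrableOn_of_bounded (M := C) ?_ hm.aestronglyMeasurable
    ((ae_restrict_iff' (measurableSet_Ioc.prod measurableSet_Ioc)).2 (.of_forall fun p hp ↦
      hC p ⟨Ioc_subset_Icc_self hp.1, Ioc_subset_Icc_self hp.2⟩))
  rw [Measure.prod_prod]
  exact ENNReal.mul_ne_top (by simp) (by simp)

lemma intervalIntegral_eq_zero_of_Ioo {h : ℝ → ℝ} {a b : ℝ} (hab : a ≤ b)
    (hh : ∀ t ∈ Ioo a b, h t = 0) : ∫ t in a..b, h t = 0 := by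
  rw [intervalIntegral.integral_of_le hab, integral_Ioc_eq_integral_Ioo]
  exact setIntegral_eq_zero_of_forall_eq_zero hh

/-- Associativity of Volterra convolution on `[y, x]` for a kernel vanishing on the negative
half-line. -/
lemma integral_volterra_assoc {V U g : ℝ → ℝ}
    (hVm : Measurable V) (hVb : LocBdd V) (hVneg : ∀ t < 0, V t = 0)
    (hUm : Measurable U) (hUb : LocBdd U) (hgm : Measurable g) (hgb : LocBdd g)
    {x y : ℝ} (hyx : y ≤ x) :
    ∫ z in y..x, (∫ u in z..x, g u * V (u - z)) * U (z - y) =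
      ∫ u in y..x, g u * ∫ t in (0 : ℝ)..(u - y), V (u - y - t) * U t := by
  have h₁ : ∀ z ∈ uIcc y x, (∫ u in z..x, g u * V (u - z)) * U (z - y) =
      ∫ u in y..x, g u * V (u - z) * U (z - y) := by
    intro z hz
    rw [uIcc_of_le hyx] at hz
    have hi : ∀ a b, IntervalIntegrable (fun u ↦ g u * V (u - z)) volume a b :=
      (hgb.mul (hVb.comp_continuous (by fun_prop))).intervalIntegrable (by fun_prop)
    rw [intervalIntegral.integral_mul_const,
      ← intervalIntegral.integral_add_adjacent_intervals (hi y z) (hi z x),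
      intervalIntegral_eq_zero_of_Ioo hz.1, zero_add]
    intro u hu
    rw [hVneg _ (sub_neg.2 hu.2), mul_zero]
  have h₂ : ∀ u ∈ uIcc y x, ∫ z in y..x, g u * V (u - z) * U (z - y) =
      g u * ∫ t in (0 : ℝ)..(u - y), V (u - y - t) * U t := by
    intro u hu
    rw [uIcc_of_le hyx] at hu
    have hi : ∀ a b, IntervalIntegrable (fun z ↦ V (u - z) * U (z - y)) volume a b :=
      ((hVb.comp_continuous (by fun_prop)).mul
        (hUb.comp_continuous (by fun_prop))).intervalIntegrable (by fun_prop)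
    have hs : ∫ t in (0 : ℝ)..(u - y), V (u - y - t) * U t =
        ∫ z in y..u, V (u - z) * U (z - y) := by
      have := intervalIntegral.integral_comp_sub_right (a := y) (b := u)
        (fun t ↦ V (u - y - t) * U t) y
      simpa using this.symm
    simp only [mul_assoc]
    rw [intervalIntegral.integral_const_mul, hs,
      ← intervalIntegral.integral_add_adjacent_intervals (hi y u) (hi u x),
      intervalIntegral_eq_zero_of_Ioo hu.2, add_zero]
    intro z hz
    rw [hVneg _ (sub_neg.2 hz.1), zero_mul]
  rw [intervalIntegral.integral_congr h₁, ← intervalIntegral.integral_congr h₂]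
  exact LocBdd.intervalIntegral_swap (h := fun p ↦ g p.2 * V (p.2 - p.1) * U (p.1 - y))
    (((hgb.comp_continuous continuous_snd).mul (hVb.comp_continuous (by fun_prop))).mul
      (hUb.comp_continuous (by fun_prop))) (by fun_prop) hyx hyx

/-- `F(x,y) - W^{(q)}(x-y) = ∫_y^x F(x,z) (ω(z) - q) W^{(q)}(z-y) dz` for `x ≥ y`,
for a solution `F` of the dual equation (B). -/
theorem statement7
    (W ω : ℝ → ℝ)
    (hWmeas : Measurable W) (hWbdd : LocBdd W) (hWneg : ∀ x : ℝ, x < 0 → W x = 0)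
    (hωmeas : Measurable ω) (hωbdd : LocBdd ω) (hωpos : ∀ x : ℝ, 0 ≤ ω x)
    (F : ℝ × ℝ → ℝ) (hFmeas : Measurable F) (hFbdd : LocBdd F)
    (hFB : ∀ x y : ℝ, F (x, y) = W (x - y) + ∫ z in y..x, F (x, z) * ω z * W (z - y))
    (q : ℝ) (hq : 0 ≤ q)
    (Wq : ℝ → ℝ)
    (hWqmeas : Measurable Wq) (hWqbdd : LocBdd Wq) (hWqneg : ∀ x : ℝ, x < 0 → Wq x = 0)
    (hWqeq : ∀ x : ℝ, Wq x = W x + q * ∫ z in (0 : ℝ)..x, W (x - z) * Wq z) :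
    ∀ x y : ℝ, y ≤ x →
      F (x, y) - Wq (x - y) = ∫ z in y..x, F (x, z) * (ω z - q) * Wq (z - y) := by
  intro x y hyx
  have hfm : Measurable fun z ↦ F (x, z) := by fun_prop
  have hfb : LocBdd fun z ↦ F (x, z) := hFbdd.comp_continuous (by fun_prop)
  have hUb : LocBdd fun z ↦ Wq (z - y) := hWqbdd.comp_continuous (by fun_prop)
  have hVb : LocBdd fun z ↦ W (z - y) := hWbdd.comp_continuous (by fun_prop)
  have hVb' : LocBdd fun z ↦ W (x - z) := hWbdd.comp_continuous (by fun_prop)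
  have hgm : Measurable fun z ↦ F (x, z) * ω z := hfm.mul hωmeas
  have hgb : LocBdd fun z ↦ F (x, z) * ω z := hfb.mul hωbdd
  have hfU : IntervalIntegrable (fun z ↦ F (x, z) * Wq (z - y)) volume y x :=
    (hfb.mul hUb).intervalIntegrable (by fun_prop) _ _
  have hWU : IntervalIntegrable (fun z ↦ W (x - z) * Wq (z - y)) volume y x :=
    (hVb'.mul hUb).intervalIntegrable (by fun_prop) _ _
  have hgU : IntervalIntegrable (fun z ↦ F (x, z) * ω z * Wq (z - y)) volume y x :=
    (hgb.mul hUb).intervalIntegrable (by fun_prop) _ _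
  have hgV : IntervalIntegrable (fun z ↦ F (x, z) * ω z * W (z - y)) volume y x :=
    (hgb.mul hVb).intervalIntegrable (by fun_prop) _ _
  have hsplit : ∫ z in y..x, F (x, z) * (ω z - q) * Wq (z - y) =
      (∫ z in y..x, F (x, z) * ω z * Wq (z - y)) - q * ∫ z in y..x, F (x, z) * Wq (z - y) := by
    rw [← intervalIntegral.integral_const_mul,
      ← intervalIntegral.integral_sub hgU (hfU.const_mul q)]
    congr 1 with z
    ring
  have hconv : ∫ z in y..x, W (x - z) * Wq (z - y) =
      ∫ t in (0 : ℝ)..(x - y), W (x - y - t) * Wq t := by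
    have := intervalIntegral.integral_comp_sub_right (a := y) (b := x)
      (fun t ↦ W (x - y - t) * Wq t) y
    simpa using this
  have hexp : ∫ z in y..x, F (x, z) * Wq (z - y) =
      (∫ z in y..x, W (x - z) * Wq (z - y)) +
        ∫ z in y..x, (∫ u in z..x, F (x, u) * ω u * W (u - z)) * Wq (z - y) := by
    rw [← sub_eq_iff_eq_add', ← intervalIntegral.integral_sub hfU hWU]
    congr 1 with z
    rw [hFB x z]
    ring
  have hres : q * (∫ u in y..x, F (x, u) * ω u *
        ∫ t in (0 : ℝ)..(u - y), W (u - y - t) * Wq t) =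
      (∫ z in y..x, F (x, z) * ω z * Wq (z - y)) -
        ∫ z in y..x, F (x, z) * ω z * W (z - y) := by
    rw [← intervalIntegral.integral_const_mul, ← intervalIntegral.integral_sub hgU hgV]
    congr 1 with u
    rw [hWqeq (u - y)]
    ring
  rw [integral_volterra_assoc hWmeas hWbdd hWneg hWqmeas hWqbdd hgm hgb hyx, hconv] at hexp
  rw [hsplit, hexp, mul_add, hres]
  linarith [hFB x y, hWqeq (x - y)]
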